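/- Let T be a rooted chain complete tree satisfying condition (*), endowed with the coarse wedge topology, let A ∈ 𝒜(T), and let D = {t ∈ T : cf(t) ≤ ω}. Then cl(A) ∩ D = cl(A ∩ D). -/

import Mathlib

open Cardinal Ordinal Filter Set Topology

universe u v

section TreeDefs

variable {T : Type u} [PartialOrder T]

/-- `T` is a tree: the set of strict predecessors of every point is well-ordered by `<`. -/
def IsTreeOrder (T : Type u) [PartialOrder T] : Prop :=
  ∀ x : T, IsWellOrder {y : T // y < x} (· < ·)

/-- Every chain has a supremum. -/
def ChainComplete (T : Type u) [PartialOrder T] : Prop :=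
  ∀ c : Set T, IsChain (· ≤ ·) c → ∃ s, IsLUB c s

open Classical in
/-- The height `ht(x,T)` of `x`: the order type of the set of its strict predecessors. -/
noncomputable def htx (x : T) : Ordinal.{u} :=
  if h : IsWellOrder {y : T // y < x} (· < ·) then @Ordinal.type {y : T // y < x} (· < ·) h
  else 0

/-- The cofinality `cf(x)` of `ht(x,T)`. -/
noncomputable def cfx (x : T) : Cardinal.{u} := (htx x).cof

/-- `x` lies on a successor level. -/
def SuccLevel (x : T) : Prop := ∃ β : Ordinal, htx x = β + 1

/-- The set of immediate successors of `x`. -/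
def ims (x : T) : Set T := {y | x < y ∧ htx y = htx x + 1}

/-- The wedge `V_t = {s : t ≤ s}`. -/
def Vset (t : T) : Set T := {s | t ≤ s}

/-- Condition (*): every `t` with `cf(t) ≥ ω₁` has finitely many immediate successors. -/
def StarCond (T : Type u) [PartialOrder T] : Prop :=
  ∀ t : T, Cardinal.aleph 1 ≤ cfx t → (ims t).Finite

/-- The coarse wedge topology: generated by the sets `V_t` and their complements,
for `t` minimal or on a successor level. -/
def coarseWedge (T : Type u) [PartialOrder T] : TopologicalSpace T :=
  TopologicalSpace.generateFrom
    {U : Set T | ∃ t : T, (IsMin t ∨ SuccLevel t) ∧ (U = Vset t ∨ U = (Vset t)ᶜ)}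

open Classical in
/-- `s ∧ t = max (ŝ ∩ t̂)`, the largest common predecessor (when it exists). -/
noncomputable def wedge (s t : T) : T :=
  if h : ∃ m, IsGreatest {r : T | r ≤ s ∧ r ≤ t} m then h.choose else s

open Classical in
/-- `ψ(t) = ims(t)` if `cf(t) ≥ ω₁`, and `ψ(t) = {0}` (the root) otherwise. -/
noncomputable def psiSet (root : T) (t : T) : Set T :=
  if Cardinal.aleph 1 ≤ cfx t then ims t else {root}

/-- `φ` is a choice function assigning to every `t` with `cf(t) = ω` a sequence of
successor-level elements strictly below `t` converging to `t`, and the constant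
sequence at the root otherwise. -/
def PhiSpec [TopologicalSpace T] (root : T) (φ : T → ℕ → T) : Prop :=
  ∀ t : T,
    (cfx t ≠ Cardinal.aleph0 → ∀ n, φ t n = root) ∧
    (cfx t = Cardinal.aleph0 →
      (∀ n, φ t n < t ∧ SuccLevel (φ t n)) ∧ Tendsto (φ t) atTop (nhds t))

/-- Membership in the family `𝒜(T)`: countable subsets containing the root, closed
under `∧`, `φ` and `ψ`. -/
structure Admissible (root : T) (φ : T → ℕ → T) (A : Set T) : Prop where
  countable : A.Countable
  root_mem : root ∈ A
  wedge_mem : ∀ s ∈ A, ∀ t ∈ A, wedge s t ∈ A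
  phi_mem : ∀ t ∈ A, ∀ n, φ t n ∈ A
  psi_mem : ∀ t ∈ A, psiSet root t ⊆ A

/-- The height of the tree `T`: the least `α` such that the level `α` of `T` is empty. -/
noncomputable def treeHeight (T : Type u) [PartialOrder T] : Ordinal.{u} :=
  sInf {α : Ordinal | ∀ x : T, htx x ≠ α}

end TreeDefs

/-- A retractional skeleton on a compact space `K`: a family of continuous retractions
with metrizable compact ranges, indexed by an up-directed partially ordered set,
commuting under the order, continuous under countable increasing suprema, and
converging pointwise to the identity. -/
structure RetractionalSkeleton (K : Type v) [TopologicalSpace K] where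
  Γ : Type v
  [po : PartialOrder Γ]
  [ne : Nonempty Γ]
  directed : ∀ s t : Γ, ∃ u, s ≤ u ∧ t ≤ u
  r : Γ → K → K
  cont : ∀ s, Continuous (r s)
  retraction : ∀ s x, r s (r s x) = r s x
  compact_range : ∀ s, IsCompact (Set.range (r s))
  metrizable_range : ∀ s, TopologicalSpace.MetrizableSpace (Set.range (r s))
  comm : ∀ s t : Γ, s ≤ t → ∀ x, r s (r t x) = r s x ∧ r t (r s x) = r s x
  seq_sup : ∀ s : ℕ → Γ, Monotone s → ∃ t : Γ, IsLUB (Set.range s) t ∧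
      ∀ x, Tendsto (fun n => r (s n) x) atTop (nhds (r t x))
  net_conv : ∀ x : K, Tendsto (fun s : Γ => r s x) atTop (nhds x)

/-- The subset induced by a retractional skeleton: `D = ⋃ₛ rₛ[K]`. -/
def RetractionalSkeleton.inducedSet {K : Type v} [TopologicalSpace K]
    (R : RetractionalSkeleton K) : Set K :=
  ⋃ s : R.Γ, Set.range (R.r s)

/-- `A` is a `Σ`-subset of `K`: for some homeomorphic injection `h` of `K` into a cube
`[0,1]^Γ`, `h(A) = h(K) ∩ Σ(Γ)`. -/
def IsSigmaSubset {K : Type v} [TopologicalSpace K] (A : Set K) : Prop :=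
  ∃ (Γ : Type v) (h : K → Γ → Set.Icc (0 : ℝ) 1),
    Topology.IsEmbedding h ∧
      h '' A = Set.range h ∩ {x | {γ | (x γ : ℝ) ≠ 0}.Countable}

/-- `K` is a Valdivia compact space: it has a dense `Σ`-subset. -/
def IsValdivia (K : Type v) [TopologicalSpace K] : Prop :=
  ∃ A : Set K, Dense A ∧ IsSigmaSubset A

/-- The bounded topology on a product `∏_{α<ω₁} X_α`: basic open sets are the sets
`V(g,β) = {f : f↾β = g↾β}` for `β < ω₁`. -/
def boundedTopology (X : Set.Iio (Cardinal.aleph 1).ord → Type v) :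
    TopologicalSpace (∀ α, X α) :=
  TopologicalSpace.generateFrom
    {U | ∃ (g : ∀ α, X α) (β : Ordinal), β < (Cardinal.aleph 1).ord ∧
      U = {f | ∀ α : Set.Iio (Cardinal.aleph 1).ord, (α : Ordinal) < β → f α = g α}}

section TreeLemmas

variable {T : Type u} [PartialOrder T]

theorem IsTreeOrder.le_or_ge (htree : IsTreeOrder T) {a b x : T} (ha : a ≤ x) (hb : b ≤ x) :
    a ≤ b ∨ b ≤ a := by
  rcases ha.lt_or_eq with ha | rfl
  · rcases hb.lt_or_eq with hb | rfl
    · have := htree x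
      rcases trichotomous_of (α := {y : T // y < x}) (· < ·) ⟨a, ha⟩ ⟨b, hb⟩ with h | h | h
      · exact Or.inl (le_of_lt h)
      · exact Or.inl (le_of_eq (congrArg Subtype.val h))
      · exact Or.inr (le_of_lt h)
    · exact Or.inl ha.le
  · exact Or.inr hb

theorem IsTreeOrder.htx_eq_typein (htree : IsTreeOrder T) {x : T} (y : {y : T // y < x}) :
    have := htree x
    htx y.1 = Ordinal.typein (α := {y : T // y < x}) (· < ·) y := by
  intro _
  have := htree y.1
  rw [htx, dif_pos this, ← Ordinal.type_subrel]
  refine Ordinal.type_eq.2 ⟨⟨⟨fun z => ⟨⟨z.1, z.2.trans y.2⟩, z.2⟩, fun z => ⟨z.1.1, z.2⟩,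
    fun _ => rfl, fun _ => rfl⟩, Iff.rfl⟩⟩

theorem IsTreeOrder.htx_lt_htx (htree : IsTreeOrder T) {x y : T} (h : y < x) :
    htx y < htx x := by
  have := htree x
  rw [htree.htx_eq_typein ⟨y, h⟩, htx, dif_pos this]
  exact Ordinal.typein_lt_type _ _

theorem IsTreeOrder.exists_lt_htx_eq (htree : IsTreeOrder T) {x : T} {o : Ordinal}
    (h : o < htx x) : ∃ y < x, htx y = o := by
  have := htree x
  rw [htx, dif_pos this] at h
  obtain ⟨y, hy⟩ := Ordinal.typein_surj _ h
  exact ⟨y.1, y.2, (htree.htx_eq_typein y).trans hy⟩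

theorem IsTreeOrder.htx_le_htx (htree : IsTreeOrder T) {x y : T} (h : y ≤ x) :
    htx y ≤ htx x := by
  rcases h.lt_or_eq with h | rfl
  · exact (htree.htx_lt_htx h).le
  · exact le_rfl

/-- Below any point above `x` there is an immediate successor of `x`. -/
theorem IsTreeOrder.exists_mem_ims_le (htree : IsTreeOrder T) {x y : T} (h : x < y) :
    ∃ z ∈ ims x, z ≤ y ∧ ∀ w < z, w ≤ x := by
  obtain ⟨z, hzy, hz⟩ : ∃ z ≤ y, htx z = htx x + 1 := by
    rcases (Order.add_one_le_of_lt (htree.htx_lt_htx h)).lt_or_eq with h' | h'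
    · obtain ⟨z, hz, e⟩ := htree.exists_lt_htx_eq h'
      exact ⟨z, hz.le, e⟩
    · exact ⟨y, le_rfl, h'.symm⟩
  have key : ∀ w ≤ y, htx w ≤ htx x → w ≤ x := by
    intro w hw hle
    rcases htree.le_or_ge hw h.le with h1 | h1
    · exact h1
    · rcases h1.lt_or_eq with h1 | rfl
      · exact absurd (htree.htx_lt_htx h1) hle.not_gt
      · exact le_rfl
  have hlt : htx x < htx z := hz ▸ Order.lt_add_one_iff.2 le_rfl
  refine ⟨z, ⟨?_, hz⟩, hzy, fun w hw => key w (hw.le.trans hzy) ?_⟩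
  · rcases htree.le_or_ge hzy h.le with h1 | h1
    · exact absurd (htree.htx_le_htx h1) hlt.not_ge
    · exact lt_of_le_of_ne h1 (by rintro rfl; exact lt_irrefl _ hlt)
  · exact Order.lt_add_one_iff.1 (hz ▸ htree.htx_lt_htx hw)

theorem succLevel_of_mem_ims {x y : T} (h : y ∈ ims x) : SuccLevel y := ⟨_, h.2⟩

theorem SuccLevel.cfx_eq_one {x : T} (h : SuccLevel x) : cfx x = 1 := by
  obtain ⟨β, hβ⟩ := h
  rw [cfx, hβ, Ordinal.cof_add_one]

theorem SuccLevel.cfx_le_aleph0 {x : T} (h : SuccLevel x) : cfx x ≤ ℵ₀ :=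
  h.cfx_eq_one ▸ Cardinal.one_le_aleph0

theorem IsTreeOrder.cfx_eq_zero_of_isMin (htree : IsTreeOrder T) {x : T} (h : IsMin x) :
    cfx x = 0 := by
  rw [cfx, Ordinal.cof_eq_zero]
  by_contra h0
  obtain ⟨y, hy, -⟩ := htree.exists_lt_htx_eq (pos_iff_ne_zero.2 h0)
  exact h.not_lt hy

theorem IsTreeOrder.cfx_lt_aleph0_of_isMin_or_succLevel (htree : IsTreeOrder T) {x : T}
    (h : IsMin x ∨ SuccLevel x) : cfx x < ℵ₀ := by
  rcases h with h | h
  · exact htree.cfx_eq_zero_of_isMin h ▸ Cardinal.aleph0_pos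
  · exact h.cfx_eq_one ▸ Cardinal.one_lt_aleph0

theorem IsTreeOrder.isMin_or_succLevel_of_cfx_lt_aleph0 (htree : IsTreeOrder T) {x : T}
    (h : cfx x < ℵ₀) : IsMin x ∨ SuccLevel x := by
  rcases Ordinal.zero_or_succ_or_isSuccLimit (htx x) with h0 | ⟨β, hβ⟩ | h1
  · left
    intro y hy
    rcases hy.lt_or_eq with hy | rfl
    · exact absurd (h0 ▸ htree.htx_lt_htx hy) not_lt_zero
    · exact le_rfl
  · exact Or.inr ⟨β, hβ.symm.trans (Order.succ_eq_add_one β)⟩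
  · exact absurd (Ordinal.aleph0_le_cof_iff.2 (Ordinal.one_lt_cof_iff.2 h1)) h.not_ge

/-- In a chain complete tree any two points have a greatest common lower bound. -/
theorem IsTreeOrder.exists_isGreatest (htree : IsTreeOrder T) (hcc : ChainComplete T) (s t : T) :
    ∃ m, IsGreatest {r : T | r ≤ s ∧ r ≤ t} m := by
  obtain ⟨m, hm⟩ := hcc {r : T | r ≤ s ∧ r ≤ t}
    (fun a ha b hb _ => htree.le_or_ge ha.1 hb.1)
  exact ⟨m, ⟨hm.2 fun r hr => hr.1, hm.2 fun r hr => hr.2⟩, hm.1⟩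

theorem wedge_eq {s t m : T} (h : IsGreatest {r : T | r ≤ s ∧ r ≤ t} m) : wedge s t = m := by
  have h' : ∃ m, IsGreatest {r : T | r ≤ s ∧ r ≤ t} m := ⟨m, h⟩
  rw [wedge, dif_pos h']
  exact h'.choose_spec.unique h

/-- A countable set of strict predecessors of a point of uncountable cofinality is bounded
strictly below that point. -/
theorem IsTreeOrder.exists_lt_of_countable (htree : IsTreeOrder T) {t : T} (ht : ℵ₀ < cfx t)
    {S : Set T} (hS : S.Countable) (hlt : ∀ x ∈ S, x < t) : ∃ c < t, ∀ x ∈ S, x ≤ c := by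
  have hsup : sSup (htx '' S) < htx t := by
    apply Ordinal.sSup_lt_of_lt_cof
    · rw [← Ordinal.lift_cof]
      exact (Cardinal.le_aleph0_iff_set_countable.2 (hS.image htx)).trans_lt
        (Cardinal.aleph0_lt_lift.2 ht)
    · rintro _ ⟨x, hx, rfl⟩
      exact htree.htx_lt_htx (hlt x hx)
  obtain ⟨c, hc, e⟩ := htree.exists_lt_htx_eq hsup
  refine ⟨c, hc, fun x hx => ?_⟩
  have hle : htx x ≤ htx c :=
    e ▸ le_csSup ⟨htx t, by rintro _ ⟨y, hy, rfl⟩; exact (htree.htx_lt_htx (hlt y hy)).le⟩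
      ⟨x, hx, rfl⟩
  rcases htree.le_or_ge (hlt x hx).le hc.le with h | h
  · exact h
  · rcases h.lt_or_eq with h | rfl
    · exact absurd (htree.htx_lt_htx h) hle.not_gt
    · exact le_rfl

theorem isOpen_Vset [τ : TopologicalSpace T] (hτ : τ = coarseWedge T) {t : T}
    (ht : IsMin t ∨ SuccLevel t) : IsOpen (Vset t) := by
  subst hτ
  exact TopologicalSpace.isOpen_generateFrom_of_mem ⟨t, ht, Or.inl rfl⟩

theorem isOpen_compl_Vset [τ : TopologicalSpace T] (hτ : τ = coarseWedge T) {t : T}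
    (ht : IsMin t ∨ SuccLevel t) : IsOpen (Vset t)ᶜ := by
  subst hτ
  exact TopologicalSpace.isOpen_generateFrom_of_mem ⟨t, ht, Or.inr rfl⟩

/-- Coarse wedge neighbourhoods of a point on a limit level contain a nontrivial interval
below that point. -/
theorem IsTreeOrder.exists_interval_subset [τ : TopologicalSpace T] (hτ : τ = coarseWedge T)
    (htree : IsTreeOrder T) {t r : T} (hr : r < t) (ht : ℵ₀ ≤ cfx t) {U : Set T} (hU : IsOpen U)
    (htU : t ∈ U) : ∃ s < t, Set.Icc s t ⊆ U := by
  subst hτ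
  induction hU with
  | basic U hU =>
    obtain ⟨q, hq, rfl | rfl⟩ := hU
    · have hqt : q ≠ t := by
        rintro rfl
        exact ht.not_gt (htree.cfx_lt_aleph0_of_isMin_or_succLevel hq)
      exact ⟨q, lt_of_le_of_ne htU hqt, fun b hb => hb.1⟩
    · exact ⟨r, hr, fun b hb hqb => htU (le_trans hqb hb.2)⟩
  | univ => exact ⟨r, hr, Set.subset_univ _⟩
  | inter U V _ _ ihU ihV =>
    obtain ⟨a, ha, haU⟩ := ihU htU.1
    obtain ⟨b, hb, hbV⟩ := ihV htU.2
    rcases htree.le_or_ge ha.le hb.le with h | h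
    · exact ⟨b, hb, fun x hx => ⟨haU ⟨h.trans hx.1, hx.2⟩, hbV hx⟩⟩
    · exact ⟨a, ha, fun x hx => ⟨haU hx, hbV ⟨h.trans hx.1, hx.2⟩⟩⟩
  | sUnion 𝒮 _ ih =>
    obtain ⟨U, hU, htU⟩ := htU
    obtain ⟨s, hs, hsU⟩ := ih U hU htU
    exact ⟨s, hs, hsU.trans (Set.subset_sUnion_of_mem hU)⟩

/-- If `A` is closed under `∧` and misses `t`, then some neighbourhood of `t` contains no point
of `A` above `t`. -/
theorem IsTreeOrder.exists_isOpen_forall_not_le [τ : TopologicalSpace T]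
    (hτ : τ = coarseWedge T) (htree : IsTreeOrder T) {A : Set T}
    (hA : ∀ s ∈ A, ∀ t ∈ A, wedge s t ∈ A) {t : T} (ht : t ∉ A) :
    ∃ W : Set T, IsOpen W ∧ t ∈ W ∧ ∀ a ∈ A, a ∈ W → ¬ t ≤ a := by
  by_cases hne : ∃ a ∈ A, t ≤ a
  · obtain ⟨a, ha, hta⟩ := hne
    have hta : t < a := lt_of_le_of_ne hta (by rintro rfl; exact ht ha)
    obtain ⟨r, hr, hra, hrt⟩ := htree.exists_mem_ims_le hta
    refine ⟨_, isOpen_compl_Vset hτ (Or.inr (succLevel_of_mem_ims hr)), hr.1.not_ge, ?_⟩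
    intro b hb hbW htb
    apply ht
    rw [← wedge_eq (s := a) (t := b) (m := t) ⟨⟨hta.le, htb⟩, ?_⟩]
    · exact hA a ha b hb
    · rintro m ⟨hma, hmb⟩
      rcases htree.le_or_ge hma hra with h | h
      · rcases h.lt_or_eq with h | rfl
        · exact hrt m h
        · exact absurd hmb hbW
      · exact absurd (h.trans hmb) hbW
  · exact ⟨Set.univ, isOpen_univ, trivial, fun a ha _ hta => hne ⟨a, ha, hta⟩⟩

/-- If `A` is closed under `∧`, then every neighbourhood of a point of `closure A \ A` on a limit
level contains a point of `A` strictly below it, together with the interval between them. -/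
theorem IsTreeOrder.exists_mem_lt_Icc_subset [τ : TopologicalSpace T]
    (hτ : τ = coarseWedge T) (htree : IsTreeOrder T) (hcc : ChainComplete T) {A : Set T}
    (hA : ∀ s ∈ A, ∀ t ∈ A, wedge s t ∈ A) {t r : T} (hr : r < t) (hcf : ℵ₀ ≤ cfx t)
    (htA : t ∈ closure A) (ht : t ∉ A) {U : Set T} (hU : IsOpen U) (htU : t ∈ U) :
    ∃ m ∈ A, m < t ∧ Set.Icc m t ⊆ U := by
  obtain ⟨s, hst, hsU⟩ := htree.exists_interval_subset hτ hr hcf hU htU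
  obtain ⟨W, hW, htW, hWA⟩ := htree.exists_isOpen_forall_not_le hτ hA ht
  have meet : ∀ b < t, ∃ z ∈ ims b, z ≤ t ∧ ∃ a ∈ A, z ≤ a ∧ ¬ t ≤ a := by
    intro b hb
    obtain ⟨z, hz, hzt, -⟩ := htree.exists_mem_ims_le hb
    obtain ⟨a, ⟨haz, haW⟩, haA⟩ := mem_closure_iff.1 htA _
      ((isOpen_Vset hτ (Or.inr (succLevel_of_mem_ims hz))).inter hW) ⟨hzt, htW⟩
    exact ⟨z, hz, hzt, a, haA, haz, hWA a haA haW⟩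
  obtain ⟨z, hz, hzt, a, haA, hza, hta⟩ := meet s hst
  obtain ⟨m, ⟨hma, hmt⟩, hmax⟩ := htree.exists_isGreatest hcc a t
  have hmt' : m < t := lt_of_le_of_ne hmt (by rintro rfl; exact hta hma)
  obtain ⟨y, hy, hyt, b, hbA, hyb, -⟩ := meet m hmt'
  have hm : IsGreatest {r : T | r ≤ a ∧ r ≤ b} m := by
    refine ⟨⟨hma, hy.1.le.trans hyb⟩, ?_⟩
    rintro c ⟨hca, hcb⟩
    rcases htree.le_or_ge hcb hyb with h | h
    · exact hmax ⟨hca, h.trans hyt⟩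
    · exact absurd (hmax ⟨h.trans hca, hyt⟩) hy.1.not_ge
  refine ⟨m, wedge_eq hm ▸ hA a haA b hbA, hmt', fun x hx => hsU ⟨?_, hx.2⟩⟩
  exact (hmax ⟨hz.1.le.trans hza, hst.le⟩).trans hx.1

/-- Under condition (*), a countable set of points of countable cofinality has no limit points
of uncountable cofinality. -/
theorem StarCond.cfx_le_of_mem_closure [τ : TopologicalSpace T] (hτ : τ = coarseWedge T)
    (hstar : StarCond T) (htree : IsTreeOrder T) (hcc : ChainComplete T) {B : Set T}
    (hB : B.Countable) (hBD : ∀ b ∈ B, cfx b ≤ ℵ₀) {t : T} (ht : t ∈ closure B) :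
    cfx t ≤ ℵ₀ := by
  by_contra! hcf
  have hfin : (ims t).Finite :=
    hstar t (by rw [← Cardinal.succ_aleph0]; exact Order.succ_le_of_lt hcf)
  choose m hm using fun a => htree.exists_isGreatest hcc a t
  obtain ⟨c, hct, hc⟩ := htree.exists_lt_of_countable hcf
    (S := {x ∈ m '' B | x < t}) ((hB.image m).mono fun x hx => hx.1) fun x hx => hx.2
  obtain ⟨z, hz, hzt, -⟩ := htree.exists_mem_ims_le hct
  have hopen : IsOpen (Vset z ∩ ⋂ r ∈ ims t, (Vset r)ᶜ) :=
    (isOpen_Vset hτ (Or.inr (succLevel_of_mem_ims hz))).inter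
      (hfin.isOpen_biInter fun r hr => isOpen_compl_Vset hτ (Or.inr (succLevel_of_mem_ims hr)))
  obtain ⟨b, ⟨hbz, hbr⟩, hbB⟩ := mem_closure_iff.1 ht _ hopen
    ⟨hzt, Set.mem_iInter₂.2 fun r hr => hr.1.not_ge⟩
  have htb : ¬ t ≤ b := by
    intro htb
    rcases htb.lt_or_eq with h | rfl
    · obtain ⟨r, hr, hrb, -⟩ := htree.exists_mem_ims_le h
      exact Set.mem_iInter₂.1 hbr r hr hrb
    · exact (hBD t hbB).not_gt hcf
  have hmt : m b < t := lt_of_le_of_ne (hm b).1.2 fun h => htb (h ▸ (hm b).1.1)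
  exact ((hz.1.trans_le ((hm b).2 ⟨hbz, hzt⟩)).not_ge) (hc _ ⟨⟨b, hbB, rfl⟩, hmt⟩)

end TreeLemmas

theorem stmt7 {T : Type u} [PartialOrder T] [τ : TopologicalSpace T]
    (hτ : τ = coarseWedge T) (htree : IsTreeOrder T) (hcc : ChainComplete T)
    (root : T) (hroot : ∀ x : T, root ≤ x)
    (hstar : StarCond T) (φ : T → ℕ → T) (hφ : PhiSpec root φ)
    (A : Set T) (hA : Admissible root φ A) :
    closure A ∩ {u : T | cfx u ≤ Cardinal.aleph0} = closure (A ∩ {u : T | cfx u ≤ Cardinal.aleph0}) := by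
  refine Set.Subset.antisymm ?_ fun t ht =>
    ⟨closure_mono Set.inter_subset_left ht, hstar.cfx_le_of_mem_closure hτ htree hcc
      (hA.countable.mono Set.inter_subset_left) (fun b hb => hb.2) ht⟩
  rintro t ⟨htA, htD⟩
  by_cases ht : t ∈ A
  · exact subset_closure ⟨ht, htD⟩
  rcases (show cfx t ≤ ℵ₀ from htD).lt_or_eq with hcf | hcf
  · obtain ⟨W, hW, htW, hWA⟩ := htree.exists_isOpen_forall_not_le hτ hA.wedge_mem ht
    obtain ⟨a, ⟨hat, haW⟩, haA⟩ := mem_closure_iff.1 htA _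
      ((isOpen_Vset hτ (htree.isMin_or_succLevel_of_cfx_lt_aleph0 hcf)).inter hW) ⟨le_rfl, htW⟩
    exact absurd hat (hWA a haA haW)
  · have hrt : root < t := lt_of_le_of_ne (hroot t) fun h => ht (h ▸ hA.root_mem)
    refine mem_closure_iff.2 fun U hU htU => ?_
    obtain ⟨m, hmA, hmt, hmU⟩ := htree.exists_mem_lt_Icc_subset hτ hcc hA.wedge_mem hrt hcf.ge
      htA ht hU htU
    by_cases hm : cfx m ≤ ℵ₀
    · exact ⟨m, hmU ⟨le_rfl, hmt.le⟩, hmA, hm⟩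
    · have hm' : Cardinal.aleph 1 ≤ cfx m := by
        rw [← Cardinal.succ_aleph0]
        exact Order.succ_le_of_lt (not_le.1 hm)
      obtain ⟨z, hz, hzt, -⟩ := htree.exists_mem_ims_le hmt
      refine ⟨z, hmU ⟨hz.1.le, hzt⟩, hA.psi_mem m hmA ?_, (succLevel_of_mem_ims hz).cfx_le_aleph0⟩
      rwa [psiSet, if_pos hm']
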